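/- For n = 1, 2, … let 𝕋⁽ⁿ⁾ = {0 = t⁽ⁿ⁾_0 ≤ t⁽ⁿ⁾_1 ≤ ⋯ ≤ t⁽ⁿ⁾_n = 1} be deterministic partitions of [0,1] such that n·t⁽ⁿ⁾_k ∈ {0,1,2,…} and t⁽ⁿ⁾_{k+1} − t⁽ⁿ⁾_k ≤ m/n for all k, where m ≥ 1 is a fixed integer. Define a⁽ⁿ⁾(t) := n·t⁽ⁿ⁾_{k+1} − ⌊nt⌋ for t⁽ⁿ⁾_k < t ≤ t⁽ⁿ⁾_{k+1}, k = 0, …, n−1, and N(𝕋⁽ⁿ⁾) := sup{k : t⁽ⁿ⁾_k < 1}. Suppose that ∫₀^· a⁽ⁿ⁾(t) dt converges uniformly on [0,1] to ∫₀^· (b(t) − 1)/2 dt for some b ∈ L¹([0,1], dt) with b ≥ 1 almost everywhere. Then liminf_{n} N(𝕋⁽ⁿ⁾)/n ≥ ∫₀¹ g(b(t)) dt. -/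

import Mathlib

open MeasureTheory Filter

/-- The piecewise linear interpolation `g` of `n ↦ 1/n`:
`g(x) = (1 + ⌊x⌋ − x)/⌊x⌋ + (x − ⌊x⌋)/(⌊x⌋ + 1)`. -/
noncomputable def gInterp (x : ℝ) : ℝ :=
  (1 + (⌊x⌋₊ : ℝ) - x) / (⌊x⌋₊ : ℝ) + (x - (⌊x⌋₊ : ℝ)) / ((⌊x⌋₊ : ℝ) + 1)

lemma gInterp_nonneg {x : ℝ} (hx : 1 ≤ x) : 0 ≤ gInterp x := by
  have h1 : (⌊x⌋₊ : ℝ) ≤ x := Nat.floor_le (by linarith)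
  have h2 : x < ⌊x⌋₊ + 1 := Nat.lt_floor_add_one x
  unfold gInterp
  exact add_nonneg (div_nonneg (by linarith) (by positivity))
    (div_nonneg (by linarith) (by positivity))

lemma gInterp_le_inv_max {x : ℝ} (hx : 1 ≤ x) : gInterp x ≤ (max (x - 1) 1)⁻¹ := by
  have h1 : (⌊x⌋₊ : ℝ) ≤ x := Nat.floor_le (by linarith)
  have h2 : x < ⌊x⌋₊ + 1 := Nat.lt_floor_add_one x
  have h3 : (1 : ℝ) ≤ ⌊x⌋₊ := by exact_mod_cast (Nat.one_le_floor_iff x).2 hx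
  have h4 : gInterp x ≤ (⌊x⌋₊ : ℝ)⁻¹ := by
    unfold gInterp
    have h5 : (x - (⌊x⌋₊ : ℝ)) / ((⌊x⌋₊ : ℝ) + 1) ≤ (x - (⌊x⌋₊ : ℝ)) / (⌊x⌋₊ : ℝ) :=
      div_le_div_of_nonneg_left (by linarith) (by linarith) (by linarith)
    calc _ ≤ (1 + (⌊x⌋₊ : ℝ) - x) / (⌊x⌋₊ : ℝ) + (x - (⌊x⌋₊ : ℝ)) / (⌊x⌋₊ : ℝ) := by gcongr
      _ = (⌊x⌋₊ : ℝ)⁻¹ := by rw [← add_div, inv_eq_one_div]; ring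
  refine h4.trans (inv_anti₀ (by positivity) (max_le (by linarith) h3))

/-- The reciprocal tangent-line bound, stable under replacing `y` by an approximation `z`. -/
lemma inv_max_sub_le_tangent (y z : ℝ) :
    (max y 1)⁻¹ - 2 * |y - z| ≤ 2 * (max z 1)⁻¹ - (max z 1)⁻¹ ^ 2 * y := by
  have hz : 1 ≤ max z 1 := le_max_right _ _
  have hy : 1 ≤ max y 1 := le_max_right _ _
  have hd : |max z 1 - max y 1| ≤ |y - z| := by
    rw [abs_sub_comm y z]; exact abs_max_sub_max_le_abs z y 1
  have hinv : (max y 1)⁻¹ ≤ (max z 1)⁻¹ + |y - z| := by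
    have e : (max y 1)⁻¹ - (max z 1)⁻¹ = (max z 1 - max y 1) * ((max y 1)⁻¹ * (max z 1)⁻¹) := by
      field_simp
    have p0 : 0 ≤ (max y 1)⁻¹ * (max z 1)⁻¹ := by positivity
    have p1 : (max y 1)⁻¹ * (max z 1)⁻¹ ≤ 1 :=
      mul_le_one₀ (inv_le_one_of_one_le₀ hy) (by positivity) (inv_le_one_of_one_le₀ hz)
    have := le_abs_self (max z 1 - max y 1)
    have := abs_nonneg (y - z)
    nlinarith
  set c := (max z 1)⁻¹ with hc
  have c0 : 0 ≤ c := by positivity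
  have c1 : c ≤ 1 := inv_le_one_of_one_le₀ hz
  have cz : c * z ≤ 1 := by
    calc c * z ≤ c * max z 1 := by gcongr; exact le_max_left _ _
      _ = 1 := inv_mul_cancel₀ (by positivity)
  have e1 : c ^ 2 * y ≤ c + |y - z| := by
    have : c ^ 2 * (y - z) ≤ |y - z| := by
      have := le_abs_self (y - z)
      have := abs_nonneg (y - z)
      have : c ^ 2 ≤ 1 := pow_le_one₀ c0 c1
      nlinarith [sq_nonneg c]
    nlinarith
  linarith

lemma exists_continuous_tangent (b : ℝ → ℝ) (hb : IntervalIntegrable b volume 0 1)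
    (hb1 : ∀ᵐ s ∂volume, s ∈ Set.Icc (0 : ℝ) 1 → 1 ≤ b s) {ε : ℝ} (hε : 0 < ε) :
    ∃ c : ℝ → ℝ, Continuous c ∧ (∀ s, 0 ≤ c s) ∧ (∀ s, c s ≤ 1) ∧
      (∫ s in (0 : ℝ)..1, gInterp (b s)) - ε
        ≤ ∫ s in (0 : ℝ)..1, (2 * c s - c s ^ 2 * (b s - 1)) := by
  have hbi : IntegrableOn (fun s => b s - 1) (Set.Ioc 0 1) volume :=
    ((intervalIntegrable_iff_integrableOn_Ioc_of_le zero_le_one).1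
      (hb.sub intervalIntegrable_const))
  obtain ⟨β, -, hβ, hβc, hβi⟩ :=
    hbi.integrable.exists_hasCompactSupport_integral_sub_le (ε := ε / 2) (by positivity)
  have hcc : Continuous fun s => (max (β s) 1)⁻¹ :=
    (hβc.max continuous_const).inv₀ fun s => by positivity
  refine ⟨fun s => (max (β s) 1)⁻¹, hcc, fun s => by positivity,
    fun s => inv_le_one_of_one_le₀ (le_max_right _ _), ?_⟩
  have hci : IntegrableOn (fun s => 2 * (max (β s) 1)⁻¹ - (max (β s) 1)⁻¹ ^ 2 * (b s - 1))
      (Set.Ioc 0 1) volume := by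
    rw [← intervalIntegrable_iff_integrableOn_Ioc_of_le zero_le_one]
    exact ((continuous_const.mul hcc).intervalIntegrable 0 1).sub
      ((hb.sub intervalIntegrable_const).continuousOn_mul (hcc.pow 2).continuousOn)
  have hdi : IntegrableOn (fun s => ‖(b s - 1) - β s‖) (Set.Ioc 0 1) volume :=
    (hbi.sub hβi).norm
  rw [intervalIntegral.integral_of_le zero_le_one, intervalIntegral.integral_of_le zero_le_one]
  have hae : ∀ᵐ s ∂(volume.restrict (Set.Ioc (0 : ℝ) 1)), 1 ≤ b s := by
    rw [ae_restrict_iff' measurableSet_Ioc]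
    filter_upwards [hb1] with s hs h using hs ⟨h.1.le, h.2⟩
  have key := integral_mono_of_nonneg (μ := volume.restrict (Set.Ioc (0 : ℝ) 1))
    (f := fun s => gInterp (b s)) (by filter_upwards [hae] with s hs using gInterp_nonneg hs)
    (hci.add (hdi.const_mul 2)) (by
      filter_upwards [hae] with s hs
      have := gInterp_le_inv_max hs
      have := inv_max_sub_le_tangent (b s - 1) (β s)
      simp only [Pi.add_apply, Real.norm_eq_abs]
      linarith)
  simp only [Pi.add_apply] at key
  rw [integral_add hci (hdi.const_mul 2), integral_const_mul] at key
  linarith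

/-- Pointwise convergence of primitives of uniformly `L¹`-bounded functions to zero gives
convergence to zero against continuous test functions. -/
lemma tendsto_integral_mul_of_tendsto_primitive (h : ℕ → ℝ → ℝ) (C : ℝ)
    (hi : ∀ᶠ n in atTop, IntervalIntegrable (h n) volume 0 1)
    (hC : ∀ᶠ n in atTop, ∫ s in (0 : ℝ)..1, |h n s| ≤ C)
    (hlim : ∀ s ∈ Set.Icc (0 : ℝ) 1,
      Tendsto (fun n => ∫ u in (0 : ℝ)..s, h n u) atTop (nhds 0))
    (φ : ℝ → ℝ) (hφ : Continuous φ) :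
    Tendsto (fun n => ∫ s in (0 : ℝ)..1, φ s * h n s) atTop (nhds 0) := by
  rw [Metric.tendsto_atTop']
  intro ε hε
  have hC0 : 0 < |C| + 1 := by positivity
  have huc := (isCompact_Icc (a := (0 : ℝ)) (b := 1)).uniformContinuousOn_of_continuous
    hφ.continuousOn
  obtain ⟨δ, hδ, hφδ⟩ := Metric.uniformContinuousOn_iff.1 huc (ε / (2 * (|C| + 1)))
    (by positivity)
  obtain ⟨K, hK⟩ := exists_nat_one_div_lt hδ
  set p : ℕ → ℝ := fun j => j / ((K : ℝ) + 1) with hp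
  have hp0 : p 0 = 0 := by simp [hp]
  have hpK : p (K + 1) = 1 := by simp only [hp]; push_cast; exact div_self (by positivity)
  have hpm : Monotone p := fun i j hij => by simp only [hp]; gcongr
  have hpd : ∀ j, p (j + 1) - p j = 1 / ((K : ℝ) + 1) := fun j => by
    simp only [hp]; push_cast; ring
  have hpI : ∀ j ≤ K + 1, p j ∈ Set.Icc (0 : ℝ) 1 := fun j hj =>
    ⟨hp0 ▸ hpm (Nat.zero_le j), hpK ▸ hpm hj⟩
  have hsum : Tendsto (fun n => ∑ j ∈ Finset.range (K + 1), φ (p j) *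
      ((∫ u in (0 : ℝ)..p (j + 1), h n u) - ∫ u in (0 : ℝ)..p j, h n u)) atTop (nhds 0) := by
    rw [← Finset.sum_const_zero (s := Finset.range (K + 1))]
    refine tendsto_finsetSum _ fun j hj => ?_
    have hj' := Finset.mem_range.1 hj
    simpa using ((hlim _ (hpI (j + 1) (by omega))).sub
      (hlim _ (hpI j (by omega)))).const_mul (φ (p j))
  have hsum' := (Metric.tendsto_nhds.1 hsum) (ε / 2) (by positivity)
  obtain ⟨n₀, hn₀⟩ := eventually_atTop.1 (hi.and (hC.and hsum'))
  refine ⟨n₀, fun n hn => ?_⟩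
  obtain ⟨hin, hCn, hsn⟩ := hn₀ n hn.le
  rw [dist_zero_right, Real.norm_eq_abs] at hsn ⊢
  have hsub : ∀ x ∈ Set.Icc (0 : ℝ) 1, ∀ y ∈ Set.Icc (0 : ℝ) 1,
      IntervalIntegrable (h n) volume x y := fun x hx y hy =>
    hin.mono_set (by
      rw [Set.uIcc_of_le (zero_le_one (α := ℝ))]
      exact Set.uIcc_subset_Icc hx hy)
  have hdec : ∀ f : ℝ → ℝ, (∀ j < K + 1, IntervalIntegrable f volume (p j) (p (j + 1))) →
      ∫ s in (0 : ℝ)..1, f s = ∑ j ∈ Finset.range (K + 1), ∫ s in p j..p (j + 1), f s := by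
    intro f hf
    rw [intervalIntegral.sum_integral_adjacent_intervals hf, hp0, hpK]
  have hjint : ∀ j < K + 1, IntervalIntegrable (h n) volume (p j) (p (j + 1)) := fun j hj =>
    hsub _ (hpI j (by omega)) _ (hpI (j + 1) (by omega))
  have hpiece : ∀ j ∈ Finset.range (K + 1),
      |(∫ s in p j..p (j + 1), φ s * h n s) - φ (p j) *
        ((∫ u in (0 : ℝ)..p (j + 1), h n u) - ∫ u in (0 : ℝ)..p j, h n u)|
      ≤ ε / (2 * (|C| + 1)) * ∫ s in p j..p (j + 1), |h n s| := by
    intro j hj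
    have hj' := Finset.mem_range.1 hj
    have h0 : (0 : ℝ) ∈ Set.Icc (0 : ℝ) 1 := by simp
    rw [intervalIntegral.integral_interval_sub_left (hsub _ h0 _ (hpI (j + 1) (by omega)))
      (hsub _ h0 _ (hpI j (by omega))), ← intervalIntegral.integral_const_mul,
      ← intervalIntegral.integral_sub ((hjint j hj').continuousOn_mul hφ.continuousOn)
        ((hjint j hj').const_mul _), ← intervalIntegral.integral_const_mul, ← Real.norm_eq_abs]
    refine intervalIntegral.norm_integral_le_of_norm_le (hpm (Nat.le_succ j))
      (Eventually.of_forall fun s hs => ?_) ((hjint j hj').abs.const_mul _)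
    rw [← sub_mul, norm_mul, Real.norm_eq_abs (h n s)]
    gcongr
    have hpj := hpI j (by omega)
    have hpj1 := hpI (j + 1) (by omega)
    have hdj := hpd j
    refine (hφδ s ⟨by linarith [hpj.1, hs.1], by linarith [hpj1.2, hs.2]⟩ (p j) hpj ?_).le
    rw [Real.dist_eq, abs_of_nonneg (by linarith [hs.1])]
    linarith [hs.2]
  have hall := (Finset.abs_sum_le_sum_abs _ _).trans (Finset.sum_le_sum hpiece)
  rw [Finset.sum_sub_distrib, ← Finset.mul_sum, ← hdec _ fun j hj => (hjint j hj).abs,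
    ← hdec _ fun j hj => (hjint j hj).continuousOn_mul hφ.continuousOn] at hall
  have hb : ε / (2 * (|C| + 1)) * ∫ s in (0 : ℝ)..1, |h n s| < ε / 2 := by
    calc _ ≤ ε / (2 * (|C| + 1)) * |C| := by gcongr; exact hCn.trans (le_abs_self C)
      _ < ε / (2 * (|C| + 1)) * (|C| + 1) := by gcongr; linarith
      _ = ε / 2 := by field_simp
  rw [abs_lt] at hsn ⊢
  rw [abs_le] at hall
  constructor <;> linarith [hall.1, hall.2]

section Block

variable {n m : ℕ} {x y : ℝ} {f : ℝ → ℝ}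

lemma intervalIntegrable_of_eq_sub_floor (hxy : x ≤ y)
    (hf : ∀ s, x < s → s ≤ y → f s = (n : ℝ) * y - (⌊(n : ℝ) * s⌋₊ : ℝ)) :
    IntervalIntegrable f volume x y := by
  have hanti : Antitone fun s : ℝ => (n : ℝ) * y - (⌊(n : ℝ) * s⌋₊ : ℝ) := fun u v huv => by
    have : ⌊(n : ℝ) * u⌋₊ ≤ ⌊(n : ℝ) * v⌋₊ := Nat.floor_le_floor (by gcongr)
    have : (⌊(n : ℝ) * u⌋₊ : ℝ) ≤ ⌊(n : ℝ) * v⌋₊ := by exact_mod_cast this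
    simp only
    linarith
  refine (hanti.intervalIntegrable (μ := volume) (a := x) (b := y)).congr fun s hs => ?_
  rw [Set.uIoc_of_le hxy] at hs
  exact (hf s hs.1 hs.2).symm

lemma le_of_eq_sub_floor (hx : 0 ≤ x)
    (hf : ∀ s, x < s → s ≤ y → f s = (n : ℝ) * y - (⌊(n : ℝ) * s⌋₊ : ℝ))
    {s : ℝ} (hs : s ∈ Set.Ioc x y) : (n : ℝ) * (y - s) ≤ f s := by
  rw [hf s hs.1 hs.2]
  have : (⌊(n : ℝ) * s⌋₊ : ℝ) ≤ n * s :=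
    Nat.floor_le (mul_nonneg (Nat.cast_nonneg n) (hx.trans hs.1.le))
  linarith

lemma eq_sub_floor_le (hn : 1 ≤ n) (hlen : y - x ≤ (m : ℝ) / n)
    (hf : ∀ s, x < s → s ≤ y → f s = (n : ℝ) * y - (⌊(n : ℝ) * s⌋₊ : ℝ))
    {s : ℝ} (hs : s ∈ Set.Ioc x y) : f s ≤ m + 1 := by
  rw [hf s hs.1 hs.2]
  have h1 := Nat.lt_floor_add_one ((n : ℝ) * s)
  have hn0 : (0 : ℝ) < n := by exact_mod_cast hn
  rw [le_div_iff₀ hn0] at hlen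
  nlinarith [hs.1]

/-- On a single block, the tangent functional is at most one intervention, up to the
oscillation `δ` of the test function. -/
lemma integral_tangent_block_le (hn : 1 ≤ n) (hx : 0 ≤ x) (hxy : x ≤ y)
    (hlen : y - x ≤ (m : ℝ) / n)
    (hf : ∀ s, x < s → s ≤ y → f s = (n : ℝ) * y - (⌊(n : ℝ) * s⌋₊ : ℝ))
    {c : ℝ → ℝ} (hc : Continuous c) (hc0 : ∀ s, 0 ≤ c s) (hc1 : ∀ s, c s ≤ 1)
    {δ : ℝ} (hδ : ∀ s ∈ Set.Ioc x y, |c s - c x| ≤ δ) :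
    ∫ s in x..y, (2 * c s - c s ^ 2 * (2 * f s))
      ≤ 1 / n + δ * (4 * m + 6) * (y - x) := by
  have hn0 : (0 : ℝ) < n := by exact_mod_cast hn
  have hfi := intervalIntegrable_of_eq_sub_floor hxy hf
  set γ := c x with hγ
  have hmono : ∫ s in x..y, (2 * c s - c s ^ 2 * (2 * f s))
      ≤ ∫ s in x..y, (2 * γ - γ ^ 2 * (2 * (n * (y - s))) + δ * (4 * m + 6)) := by
    refine intervalIntegral.integral_mono_on_of_le_Ioo hxy
      (((continuous_const.mul hc).intervalIntegrable _ _).sub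
        ((hfi.const_mul 2).continuousOn_mul (hc.pow 2).continuousOn))
      (Continuous.intervalIntegrable (by fun_prop) _ _) fun s hs => ?_
    have hs' : s ∈ Set.Ioc x y := ⟨hs.1, hs.2.le⟩
    have h1 := le_of_eq_sub_floor hx hf hs'
    have h2 := eq_sub_floor_le hn hlen hf hs'
    have h3 := abs_le.1 (hδ s hs')
    have h4 : 0 ≤ f s := le_trans (mul_nonneg hn0.le (by linarith [hs.2])) h1
    have h5 : γ ^ 2 * (2 * (n * (y - s))) ≤ γ ^ 2 * (2 * f s) := by gcongr
    have h6 : γ ^ 2 - c s ^ 2 ≤ 2 * δ := by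
      nlinarith [hc0 s, hc1 s, hc0 x, hc1 x]
    have h7 : (γ ^ 2 - c s ^ 2) * (2 * f s) ≤ 2 * δ * (2 * (m + 1)) := by
      have : 0 ≤ δ := (abs_nonneg _).trans (hδ s hs')
      calc _ ≤ 2 * δ * (2 * f s) := by gcongr
        _ ≤ _ := by gcongr
    linarith
  refine hmono.trans ?_
  have hval : ∫ s in x..y, (2 * γ - γ ^ 2 * (2 * (n * (y - s))) + δ * (4 * m + 6))
      = 2 * γ * (y - x) - γ ^ 2 * n * (y - x) ^ 2 + δ * (4 * m + 6) * (y - x) := by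
    rw [intervalIntegral.integral_eq_sub_of_hasDerivAt
      (f := fun s => 2 * γ * s + γ ^ 2 * n * (y - s) ^ 2 + δ * (4 * m + 6) * s)]
    · ring
    · intro s _
      have h := (((hasDerivAt_id s).const_mul (2 * γ)).add
        ((((hasDerivAt_id s).const_sub y).pow 2).const_mul (γ ^ 2 * n))).add
        ((hasDerivAt_id s).const_mul (δ * (4 * m + 6)))
      refine h.congr_deriv ?_
      simp only [id]
      push_cast
      ring
    · exact Continuous.intervalIntegrable (by fun_prop) _ _
  rw [hval]
  have : 2 * γ * (y - x) - γ ^ 2 * n * (y - x) ^ 2 ≤ 1 / n := by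
    rw [le_div_iff₀ hn0]
    nlinarith [sq_nonneg (γ * n * (y - x) - 1)]
  linarith

end Block

/-- Convex lower bound on the number of interventions of a single partition. -/
lemma integral_tangent_le_interventions {n m : ℕ} (hn : 1 ≤ n) {t : ℕ → ℝ}
    (ht0 : t 0 = 0) (htn : t n = 1) (hmono : ∀ k, k < n → t k ≤ t (k + 1))
    (hmesh : ∀ k, k < n → t (k + 1) - t k ≤ (m : ℝ) / n) {f : ℝ → ℝ}
    (hf : ∀ k, k < n → ∀ s : ℝ, t k < s → s ≤ t (k + 1) →
      f s = (n : ℝ) * t (k + 1) - (⌊(n : ℝ) * s⌋₊ : ℝ))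
    {c : ℝ → ℝ} (hc : Continuous c) (hc0 : ∀ s, 0 ≤ c s) (hc1 : ∀ s, c s ≤ 1)
    {δ : ℝ}
    (hδ : ∀ x ∈ Set.Icc (0 : ℝ) 1, ∀ y ∈ Set.Icc (0 : ℝ) 1, |y - x| ≤ (m : ℝ) / n →
      |c y - c x| ≤ δ) :
    IntervalIntegrable f volume 0 1 ∧ (∀ s ∈ Set.Ioc (0 : ℝ) 1, |f s| ≤ m + 1) ∧
    ∫ s in (0 : ℝ)..1, (2 * c s - c s ^ 2 * (2 * f s))
      ≤ (((sSup {k : ℕ | k ≤ n ∧ t k < 1} : ℕ) : ℝ) + 1) / n + δ * (4 * m + 6) := by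
  have hmon : MonotoneOn t (Set.Iic n) := by
    refine monotoneOn_of_le_succ Set.ordConnected_Iic fun k _ _ hk => hmono k ?_
    exact Nat.lt_of_succ_le hk
  have hI : ∀ k ≤ n, t k ∈ Set.Icc (0 : ℝ) 1 := fun k hk =>
    ⟨ht0 ▸ hmon (Set.mem_Iic.2 (Nat.zero_le n)) (Set.mem_Iic.2 hk) (Nat.zero_le k),
      htn ▸ hmon (Set.mem_Iic.2 hk) (Set.mem_Iic.2 le_rfl) hk⟩
  have hfi : ∀ k < n, IntervalIntegrable f volume (t k) (t (k + 1)) := fun k hk =>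
    intervalIntegrable_of_eq_sub_floor (hmono k hk) (hf k hk)
  have hfint : IntervalIntegrable f volume 0 1 := by
    have := IntervalIntegrable.trans_iterate hfi
    rwa [ht0, htn] at this
  refine ⟨hfint, fun s hs => ?_, ?_⟩
  · have hex : ∃ k, s ≤ t k := ⟨n, htn ▸ hs.2⟩
    obtain ⟨k, hk⟩ : ∃ k, Nat.find hex = k + 1 := Nat.exists_eq_succ_of_ne_zero fun h0 => by
      have := Nat.find_spec hex
      rw [h0, ht0] at this
      exact absurd hs.1 (not_lt.2 this)
    have hkn : k < n := by
      have : Nat.find hex ≤ n := Nat.find_min' hex (htn ▸ hs.2)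
      omega
    have hs1 : s ≤ t (k + 1) := hk ▸ Nat.find_spec hex
    have hs0 : t k < s := not_le.1 (Nat.find_min hex (by omega))
    have hlow := le_of_eq_sub_floor (hI k hkn.le).1 (hf k hkn) ⟨hs0, hs1⟩
    rw [abs_of_nonneg (le_trans (mul_nonneg (Nat.cast_nonneg n) (by linarith)) hlow)]
    exact eq_sub_floor_le hn (hmesh k hkn) (hf k hkn) ⟨hs0, hs1⟩
  set N := sSup {k : ℕ | k ≤ n ∧ t k < 1} with hN
  have hbdd : BddAbove {k : ℕ | k ≤ n ∧ t k < 1} := ⟨n, fun k hk => hk.1⟩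
  have hFi : ∀ k < n, IntervalIntegrable (fun s => 2 * c s - c s ^ 2 * (2 * f s)) volume
      (t k) (t (k + 1)) := fun k hk =>
    ((continuous_const.mul hc).intervalIntegrable _ _).sub
      (((hfi k hk).const_mul 2).continuousOn_mul (hc.pow 2).continuousOn)
  have hsum := intervalIntegral.sum_integral_adjacent_intervals hFi
  rw [ht0, htn] at hsum
  rw [← hsum]
  have hterm : ∀ k ∈ Finset.range n, ∫ s in t k..t (k + 1), (2 * c s - c s ^ 2 * (2 * f s))
      ≤ (if k ∈ Finset.range (N + 1) then 1 / (n : ℝ) else 0)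
        + δ * (4 * m + 6) * (t (k + 1) - t k) := by
    intro k hk
    rw [Finset.mem_range] at hk
    split_ifs with hkN
    · refine integral_tangent_block_le hn (hI k hk.le).1 (hmono k hk) (hmesh k hk) (hf k hk)
        hc hc0 hc1 fun s hs => ?_
      have hk1 := (hI (k + 1) hk).2
      have hk0 := (hI k hk.le).1
      refine hδ _ (hI k hk.le) s ⟨by linarith [hs.1], by linarith [hs.2]⟩ ?_
      rw [abs_of_nonneg (by linarith [hs.1])]
      linarith [hs.2, hmesh k hk]
    · have h1 : 1 ≤ t k := by
        by_contra! h
        exact hkN (Finset.mem_range.2 (Nat.lt_succ_of_le (le_csSup hbdd ⟨hk.le, h⟩)))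
      have h2 : t k = 1 := le_antisymm (hI k hk.le).2 h1
      have h3 : t (k + 1) = 1 := le_antisymm (hI (k + 1) hk).2 (h1.trans (hmono k hk))
      simp [h2, h3]
  refine (Finset.sum_le_sum hterm).trans ?_
  rw [Finset.sum_add_distrib, ← Finset.mul_sum, Finset.sum_range_sub, ht0, htn, sub_zero, mul_one]
  gcongr
  rw [← Finset.sum_filter, Finset.sum_const, nsmul_eq_mul, mul_one_div]
  gcongr
  have : (Finset.filter (fun k => k ∈ Finset.range (N + 1)) (Finset.range n)).card ≤ N + 1 := by
    calc _ ≤ (Finset.range (N + 1)).card :=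
          Finset.card_le_card fun k hk => (Finset.mem_filter.1 hk).2
      _ = N + 1 := Finset.card_range _
  exact_mod_cast this

/-- Let `𝕋⁽ⁿ⁾ = {0 = t⁽ⁿ⁾_0 ≤ ⋯ ≤ t⁽ⁿ⁾_n = 1}` be deterministic partitions
of `[0,1]` with grid points in `(1/n)·ℕ` and mesh at most `m/n`, and let
`a⁽ⁿ⁾(s) = n t⁽ⁿ⁾_{k+1} − ⌊ns⌋` for `s ∈ (t⁽ⁿ⁾_k, t⁽ⁿ⁾_{k+1}]`. If `∫₀^· a⁽ⁿ⁾(s) ds`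
converges uniformly on `[0,1]` to `∫₀^· (b(s) − 1)/2 ds` for some `b ∈ L¹([0,1])` with
`b ≥ 1` a.e., then `liminf_n N(𝕋⁽ⁿ⁾)/n ≥ ∫₀¹ g(b(s)) ds`, where
`N(𝕋⁽ⁿ⁾) = sup{k : t⁽ⁿ⁾_k < 1}`. -/
theorem liminf_interventions_ge (m : ℕ) (hm : 1 ≤ m) (t : ℕ → ℕ → ℝ)
    (ht0 : ∀ n : ℕ, 1 ≤ n → t n 0 = 0)
    (htn : ∀ n : ℕ, 1 ≤ n → t n n = 1)
    (hmono : ∀ n : ℕ, 1 ≤ n → ∀ k, k < n → t n k ≤ t n (k + 1))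
    (hgrid : ∀ n : ℕ, 1 ≤ n → ∀ k ≤ n, ∃ j : ℕ, (n : ℝ) * t n k = (j : ℝ))
    (hmesh : ∀ n : ℕ, 1 ≤ n → ∀ k, k < n → t n (k + 1) - t n k ≤ (m : ℝ) / n)
    (a : ℕ → ℝ → ℝ)
    (ha : ∀ n : ℕ, 1 ≤ n → ∀ k, k < n → ∀ s : ℝ, t n k < s → s ≤ t n (k + 1) →
      a n s = (n : ℝ) * t n (k + 1) - (⌊(n : ℝ) * s⌋₊ : ℝ))
    (b : ℝ → ℝ) (hbL1 : IntervalIntegrable b volume 0 1)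
    (hb1 : ∀ᵐ s ∂volume, s ∈ Set.Icc (0 : ℝ) 1 → 1 ≤ b s)
    (hunif : TendstoUniformlyOn (fun n s => ∫ u in (0 : ℝ)..s, a n u)
      (fun s => ∫ u in (0 : ℝ)..s, (b u - 1) / 2) atTop (Set.Icc 0 1)) :
    (∫ s in (0 : ℝ)..1, gInterp (b s)) ≤
      atTop.liminf fun n => ((sSup {k : ℕ | k ≤ n ∧ t n k < 1} : ℕ) : ℝ) / n := by
  have hbound : ∀ n : ℕ, ((sSup {k : ℕ | k ≤ n ∧ t n k < 1} : ℕ) : ℝ) / n ≤ 1 := fun n => by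
    refine div_le_one_of_le₀ ?_ (Nat.cast_nonneg n)
    have h : sSup {k : ℕ | k ≤ n ∧ t n k < 1} ≤ n :=
      csSup_le' (mem_upperBounds.2 fun k hk => hk.1)
    exact_mod_cast h
  refine le_of_forall_pos_le_add fun ε hε => ?_
  rw [← sub_le_iff_le_add]
  refine le_liminf_of_le (isCoboundedUnder_ge_of_le atTop hbound) ?_
  obtain ⟨c, hc, hc0, hc1, hcε⟩ := exists_continuous_tangent b hbL1 hb1 (ε := ε / 4)
    (by positivity)
  have hM : (0 : ℝ) < 4 * m + 6 := by positivity
  obtain ⟨η, hη, hcη⟩ := Metric.uniformContinuousOn_iff.1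
    ((isCompact_Icc (a := (0 : ℝ)) (b := 1)).uniformContinuousOn_of_continuous hc.continuousOn)
    (ε / 4 / (4 * m + 6)) (by positivity)
  have hmn : ∀ᶠ n : ℕ in atTop, (m : ℝ) / n < η :=
    (tendsto_const_div_atTop_nhds_zero_nat (m : ℝ)).eventually_lt_const hη
  have hblock : ∀ᶠ n : ℕ in atTop, IntervalIntegrable (a n) volume 0 1 ∧
      (∀ s ∈ Set.Ioc (0 : ℝ) 1, |a n s| ≤ m + 1) ∧
      ∫ s in (0 : ℝ)..1, (2 * c s - c s ^ 2 * (2 * a n s))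
        ≤ (((sSup {k : ℕ | k ≤ n ∧ t n k < 1} : ℕ) : ℝ) + 1) / n + ε / 4 := by
    filter_upwards [hmn, eventually_ge_atTop 1] with n hnη hn
    have := integral_tangent_le_interventions hn (ht0 n hn) (htn n hn) (hmono n hn)
      (hmesh n hn) (ha n hn) hc hc0 hc1 (δ := ε / 4 / (4 * m + 6))
      fun x hx y hy hxy => (hcη y hy x hx (hxy.trans_lt hnη)).le
    rwa [div_mul_cancel₀ _ hM.ne'] at this
  have hBi : IntervalIntegrable (fun s => (b s - 1) / 2) volume 0 1 :=
    (hbL1.sub intervalIntegrable_const).div_const 2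
  have hsub : ∀ f : ℝ → ℝ, IntervalIntegrable f volume 0 1 → ∀ s ∈ Set.Icc (0 : ℝ) 1,
      IntervalIntegrable f volume 0 s := fun f hf s hs =>
    hf.mono_set (by
      rw [Set.uIcc_of_le (zero_le_one (α := ℝ)), Set.uIcc_of_le hs.1]
      exact Set.Icc_subset_Icc_right hs.2)
  have hweak := tendsto_integral_mul_of_tendsto_primitive (fun n s => a n s - (b s - 1) / 2)
    (m + 1 + ∫ s in (0 : ℝ)..1, |(b s - 1) / 2|)
    (hblock.mono fun n hn => hn.1.sub hBi)
    (hblock.mono fun n hn => by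
      have : ∫ s in (0 : ℝ)..1, |a n s - (b s - 1) / 2|
          ≤ ∫ s in (0 : ℝ)..1, ((m + 1 : ℝ) + |(b s - 1) / 2|) := by
        refine intervalIntegral.integral_mono_on_of_le_Ioo zero_le_one (hn.1.sub hBi).abs
          (intervalIntegrable_const.add hBi.abs) fun s hs => ?_
        exact (abs_sub _ _).trans (by gcongr; exact hn.2.1 s ⟨hs.1, hs.2.le⟩)
      rw [intervalIntegral.integral_add intervalIntegrable_const hBi.abs] at this
      simpa using this)
    (fun s hs => by
      have h := (hunif.tendsto_at hs).sub_const (∫ u in (0 : ℝ)..s, (b u - 1) / 2)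
      rw [sub_self] at h
      refine h.congr' (hblock.mono fun n hn => ?_)
      exact (intervalIntegral.integral_sub (hsub _ hn.1 s hs) (hsub _ hBi s hs)).symm)
    (fun s => c s ^ 2 * 2) (by fun_prop)
  have hn1 : ∀ᶠ n : ℕ in atTop, (1 : ℝ) / n < ε / 4 :=
    (tendsto_const_div_atTop_nhds_zero_nat (1 : ℝ)).eventually_lt_const (by positivity)
  filter_upwards [hblock, hweak.eventually_lt_const (show 0 < ε / 4 by positivity), hn1]
    with n hn hw h1
  obtain ⟨hai, -, hN⟩ := hn
  have hci : IntervalIntegrable (fun s => 2 * c s) volume 0 1 :=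
    (continuous_const.mul hc).intervalIntegrable _ _
  have heq : ∫ s in (0 : ℝ)..1, (2 * c s - c s ^ 2 * (b s - 1))
      = (∫ s in (0 : ℝ)..1, (2 * c s - c s ^ 2 * (2 * a n s)))
        + ∫ s in (0 : ℝ)..1, c s ^ 2 * 2 * (a n s - (b s - 1) / 2) := by
    have hi₁ : IntervalIntegrable (fun s => 2 * c s - c s ^ 2 * (2 * a n s)) volume 0 1 :=
      hci.sub ((hai.const_mul 2).continuousOn_mul (hc.pow 2).continuousOn)
    have hi₂ : IntervalIntegrable (fun s => c s ^ 2 * 2 * (a n s - (b s - 1) / 2)) volume 0 1 :=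
      (hai.sub hBi).continuousOn_mul ((hc.pow 2).mul continuous_const).continuousOn
    rw [← intervalIntegral.integral_add hi₁ hi₂]
    congr 1
    ext s
    ring
  rw [add_div] at hN
  linarith
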